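/- Appendix B solution of the linear ∇̃-equation, general case: let ε > 0, let g : ℂ → ℂ be holomorphic on the annulus A_ε and not identically zero on A_ε, let M ≤ N with M ≥ 1, and let A : Fin M → ((Fin N → ℂ) → ℂ) be a family of functions, each holomorphic on A_ε^N, such that ∑_{a : Fin M} A a z * g (z a) = 0 for all z ∈ A_ε^N (with a viewed in Fin N via the inclusion Fin M ↪ Fin N). Then there exists a family A' : Fin M → Fin M → ((Fin N → ℂ) → ℂ), each A' a b holomorphic on A_ε^N, antisymmetric in the sense A' a b z = −A' b a z, such that A a z = ∑_{b : Fin M} A' a b z * g (z b) for all a and all z ∈ A_ε^N. -/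

import Mathlib

open Finset

/-- The annulus `A_ε = {z : ℂ | 1 − ε < ‖z‖ < 1 + ε}` around the unit circle. -/
def annulus (ε : ℝ) : Set ℂ := {z : ℂ | 1 - ε < ‖z‖ ∧ ‖z‖ < 1 + ε}

/-- The polyannulus `A_ε^N = {z : Fin N → ℂ | ∀ i, z i ∈ A_ε}`. -/
def polyAnnulus (ε : ℝ) (N : ℕ) : Set (Fin N → ℂ) := {z | ∀ i, z i ∈ annulus ε}


lemma weier {E : Type*} [NormedAddCommGroup E] [NormedSpace ℂ E] {U : Set E} (hU : IsOpen U)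
    (F : ℕ → E → ℂ) (f : E → ℂ) (hF : ∀ᶠ n in Filter.atTop, DifferentiableOn ℂ (F n) U)
    (h : TendstoUniformlyOn F f Filter.atTop U) : DifferentiableOn ℂ f U := by
  obtain ⟨n0, hn0⟩ := Filter.eventually_atTop.1 hF
  intro x hx
  apply DifferentiableAt.differentiableWithinAt
  obtain ⟨r, hr, hrU⟩ := Metric.isOpen_iff.1 hU x hx
  have hsub : Metric.ball x (r/2) ⊆ U :=
    (Metric.ball_subset_ball (by linarith)).trans hrU
  let G : ℕ → E → ℂ := fun n => F (n + n0)
  have hG : ∀ n, DifferentiableOn ℂ (G n) U := fun n => hn0 _ (by omega)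
  have hGf : TendstoUniformlyOn G f Filter.atTop U := by
    intro u hu
    exact (Filter.tendsto_add_atTop_nat n0).eventually (h u hu)
  have hC : UniformCauchySeqOn (fun n => fderiv ℂ (G n)) Filter.atTop (Metric.ball x (r/2)) := by
    rw [Metric.uniformCauchySeqOn_iff]
    intro δ hδ
    obtain ⟨n1, hn1⟩ := Metric.uniformCauchySeqOn_iff.1 hGf.uniformCauchySeqOn (δ * r / 8)
      (by positivity)
    refine ⟨n1, fun m hm n hn y hy => ?_⟩
    have hyU : Metric.ball y (r/2) ⊆ U := by
      refine Set.Subset.trans (fun z hz => ?_) hrU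
      rw [Metric.mem_ball] at *
      linarith [dist_triangle z y x]
    have hyy : y ∈ U := hsub hy
    have hd : DifferentiableOn ℂ (fun z => G m z - G n z) (Metric.ball y (r/2)) :=
      ((hG m).mono hyU).sub ((hG n).mono hyU)
    have := Complex.norm_fderiv_le_div_of_mapsTo_ball (R₂ := δ * r / 4) hd (by
      intro z hz
      have h1 := hn1 m hm n hn z (hyU hz)
      have h2 := hn1 m hm n hn y hyy
      rw [Metric.mem_closedBall]
      rw [dist_eq_norm] at *
      refine (norm_sub_le _ _).trans ?_
      linarith) (by positivity)
    rw [fderiv_fun_sub ((hG m).differentiableAt (hU.mem_nhds hyy))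
      ((hG n).differentiableAt (hU.mem_nhds hyy))] at this
    rw [dist_eq_norm]
    refine this.trans_lt ?_
    rw [div_lt_iff₀ (by positivity)]
    nlinarith
  have hlim : ∀ y ∈ Metric.ball x (r/2), ∃ L, Filter.Tendsto (fun n => fderiv ℂ (G n) y)
      Filter.atTop (nhds L) := fun y hy => cauchySeq_tendsto_of_complete (hC.cauchySeq hy)
  choose! L hL using hlim
  have := hasFDerivAt_of_tendstoUniformlyOn Metric.isOpen_ball
    (hC.tendstoUniformlyOn_of_tendsto hL)
    (fun n y hy => ((hG n).differentiableAt (hU.mem_nhds (hsub hy))).hasFDerivAt)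
    (fun y hy => (hGf.tendsto_at (hsub hy))) (Metric.mem_ball_self (by positivity) : x ∈ _)
  exact this.differentiableAt

lemma limit_exists {E : Type*} [NormedAddCommGroup E] [NormedSpace ℂ E] (U : ℕ → Set E)
    (hU : ∀ n, IsOpen (U n)) (hmono : Monotone U) (F : ℕ → E → ℂ)
    (hF : ∀ n, DifferentiableOn ℂ (F n) (U n))
    (hb : ∀ n, ∀ z ∈ U n, ‖F (n+1) z - F n z‖ ≤ (1/2 : ℝ)^n) :
    ∃ f : E → ℂ, DifferentiableOn ℂ f (⋃ n, U n) ∧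
      ∀ z ∈ ⋃ n, U n, Filter.Tendsto (fun n => F n z) Filter.atTop (nhds (f z)) := by
  have hC : ∀ m, UniformCauchySeqOn F Filter.atTop (U m) := by
    intro m
    have key : ∀ z ∈ U m, ∀ n, m ≤ n → ∀ k, ‖F (n+k) z - F n z‖ ≤ 2 * (1/2:ℝ)^n * (1 - (1/2)^k) := by
      intro z hz n hn k
      induction k with
      | zero => simp
      | succ k ih =>
        have h1 := hb (n+k) z (hmono (by omega) hz)
        have : F (n + (k+1)) z - F n z = (F (n+k+1) z - F (n+k) z) + (F (n+k) z - F n z) := by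
          rw [← add_assoc]; ring
        rw [this]
        refine (norm_add_le _ _).trans ((add_le_add h1 ih).trans (le_of_eq ?_))
        rw [pow_add, pow_succ]; ring
    have key2 : ∀ z ∈ U m, ∀ n, m ≤ n → ∀ k, n ≤ k → ‖F k z - F n z‖ ≤ 2 * (1/2:ℝ)^n := by
      intro z hz n hn k hk
      obtain ⟨j, rfl⟩ := Nat.exists_eq_add_of_le hk
      refine (key z hz n hn j).trans ?_
      have : (0:ℝ) ≤ (1/2)^j := by positivity
      have : (0:ℝ) ≤ (1/2)^n := by positivity
      nlinarith
    rw [Metric.uniformCauchySeqOn_iff]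
    intro δ hδ
    obtain ⟨n0, hn0⟩ := exists_pow_lt_of_lt_one (show 0 < δ / 4 by positivity)
      (show (1/2:ℝ) < 1 by norm_num)
    refine ⟨max m n0, fun a ha b hb z hz => ?_⟩
    have h1 := key2 z hz (max m n0) (le_max_left _ _) a ha
    have h2 := key2 z hz (max m n0) (le_max_left _ _) b hb
    have h3 : (1/2:ℝ)^(max m n0) ≤ (1/2)^n0 :=
      pow_le_pow_of_le_one (by norm_num) (by norm_num) (le_max_right _ _)
    rw [dist_eq_norm]
    have : F a z - F b z = (F a z - F (max m n0) z) - (F b z - F (max m n0) z) := by ring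
    rw [this]
    refine (norm_sub_le _ _).trans_lt ?_
    linarith
  have hlim : ∀ z ∈ ⋃ n, U n, ∃ L, Filter.Tendsto (fun n => F n z) Filter.atTop (nhds L) := by
    intro z hz
    obtain ⟨m, hm⟩ := Set.mem_iUnion.1 hz
    exact cauchySeq_tendsto_of_complete ((hC m).cauchySeq hm)
  choose! f hf using hlim
  refine ⟨f, ?_, hf⟩
  intro z hz
  obtain ⟨m, hm⟩ := Set.mem_iUnion.1 hz
  have h1 : TendstoUniformlyOn F f Filter.atTop (U m) :=
    (hC m).tendstoUniformlyOn_of_tendsto fun y hy => hf y (Set.mem_iUnion.2 ⟨m, hy⟩)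
  have h2 := weier (hU m) F f (Filter.eventually_atTop.2 ⟨m, fun n hn => (hF n).mono (hmono hn)⟩) h1
  exact (h2.differentiableAt ((hU m).mem_nhds hm)).differentiableWithinAt

/-- Set coordinate `i` to zero, as a continuous linear map. -/
noncomputable def killCoord {N : ℕ} (i : Fin N) : (Fin N → ℂ) →L[ℂ] (Fin N → ℂ) :=
  ContinuousLinearMap.pi fun j => if j = i then 0 else ContinuousLinearMap.proj j

lemma update_eq_kill {N : ℕ} (i : Fin N) (z : Fin N → ℂ) (c : ℂ) :
    Function.update z i c = killCoord i z + Pi.single i c := by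
  ext j
  by_cases h : j = i
  · subst h; simp [killCoord]
  · simp [killCoord, h]

lemma hasFDerivAt_update_left {N : ℕ} (i : Fin N) (z : Fin N → ℂ) (c : ℂ) :
    HasFDerivAt (fun z : Fin N → ℂ => Function.update z i c) (killCoord i) z := by
  simp only [update_eq_kill]
  exact (killCoord i).hasFDerivAt.add_const _

lemma differentiable_update_right {N : ℕ} (i : Fin N) (z : Fin N → ℂ) :
    Differentiable ℂ (fun c : ℂ => Function.update z i c) := by
  intro c
  exact (hasFDerivAt_update z c).differentiableAt

lemma division_aux {N : ℕ} (i : Fin N) (w : ℂ) (p : Fin N → ℂ) (hp : p i = w) (R : ℝ) (hR : 0 < R)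
    (Ω : Set (Fin N → ℂ)) (hΩ : IsOpen Ω) (hball : Metric.closedBall p R ⊆ Ω)
    (f : (Fin N → ℂ) → ℂ) (hf : DifferentiableOn ℂ f Ω) :
    DifferentiableAt ℂ (fun z => ∫ θ in (0:ℝ)..(2 * Real.pi),
      Complex.I * ((circleMap w R θ - z i)⁻¹ * f (Function.update z i (circleMap w R θ)))) p := by
  set Φ : (Fin N → ℂ) → ℝ → ℂ := fun z θ =>
    Complex.I * ((circleMap w R θ - z i)⁻¹ * f (Function.update z i (circleMap w R θ))) with hΦ
  have hu : ∀ z ∈ Metric.ball p (R/2), ∀ θ, Function.update z i (circleMap w R θ) ∈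
      Metric.closedBall p R := by
    intro z hz θ
    rw [Metric.mem_closedBall, dist_pi_le_iff hR.le]
    intro j
    by_cases h : j = i
    · subst h
      simp [hp, dist_eq_norm, abs_of_pos hR]
    · rw [Function.update_of_ne h]
      have := dist_le_pi_dist z p j
      rw [Metric.mem_ball] at hz
      linarith
  obtain ⟨C, hC⟩ := (isCompact_closedBall p R).exists_bound_of_continuousOn
    (hf.continuousOn.mono hball)
  have hC0 : 0 ≤ C := (norm_nonneg _).trans (hC p (Metric.mem_closedBall_self hR.le))
  have hden : ∀ z ∈ Metric.ball p (R/2), ∀ θ, R/2 ≤ ‖circleMap w R θ - z i‖ := by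
    intro z hz θ
    have h1 := dist_le_pi_dist z p i
    rw [Metric.mem_ball] at hz
    rw [hp, dist_eq_norm] at h1
    have h2 : ‖circleMap w R θ - w‖ = R := by simp [abs_of_pos hR]
    have h3 : ‖circleMap w R θ - w‖ ≤ ‖circleMap w R θ - z i‖ + ‖z i - w‖ := by
      simpa using norm_add_le (circleMap w R θ - z i) (z i - w)
    linarith
  have hden0 : ∀ z ∈ Metric.ball p (R/2), ∀ θ, circleMap w R θ - z i ≠ 0 := by
    intro z hz θ h
    have := hden z hz θ
    rw [h, norm_zero] at this
    linarith
  have hΦb : ∀ z ∈ Metric.ball p (R/2), ∀ θ, ‖Φ z θ‖ ≤ (R/2)⁻¹ * C := by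
    intro z hz θ
    simp only [hΦ, norm_mul, Complex.norm_I, one_mul, norm_inv]
    gcongr
    · exact hden z hz θ
    · exact hC _ (hu z hz θ)
  have hd : ∀ z ∈ Metric.ball p (R/2), ∀ θ, HasFDerivAt (fun z => Φ z θ)
      (Complex.I • ((circleMap w R θ - z i)⁻¹ •
          (fderiv ℂ f (Function.update z i (circleMap w R θ))).comp (killCoord i)
        + f (Function.update z i (circleMap w R θ)) •
          ((((circleMap w R θ - z i)^2)⁻¹) • (ContinuousLinearMap.proj i)))) z := by
    intro z hz θ
    have h1 : HasFDerivAt f (fderiv ℂ f (Function.update z i (circleMap w R θ)))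
        (Function.update z i (circleMap w R θ)) :=
      (hf.differentiableAt (hΩ.mem_nhds (hball (hu z hz θ)))).hasFDerivAt
    have h2 := h1.comp z (hasFDerivAt_update_left i z (circleMap w R θ))
    have h3 : HasFDerivAt (fun z : Fin N → ℂ => circleMap w R θ - z i)
        (-(ContinuousLinearMap.proj i : (Fin N → ℂ) →L[ℂ] ℂ)) z :=
      (hasFDerivAt_apply i z).const_sub _
    have h4 := (hasDerivAt_inv (hden0 z hz θ)).comp_hasFDerivAt z h3
    have h5 := (h4.mul h2).const_mul Complex.I
    convert! h5 using 1
    simp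
  have hcont : ∀ z ∈ Metric.ball p (R/2), Continuous (Φ z) := by
    intro z hz
    have h1 : Continuous (fun θ => Function.update z i (circleMap w R θ)) :=
      (differentiable_update_right i z).continuous.comp (continuous_circleMap w R)
    have h2 : Continuous (fun θ => f (Function.update z i (circleMap w R θ))) :=
      (hf.continuousOn.comp_continuous h1 fun θ => hball (hu z hz θ))
    refine continuous_const.mul (Continuous.mul (Continuous.inv₀ ?_ (hden0 z hz)) h2)
    exact (continuous_circleMap w R).sub continuous_const
  have hp2 : p ∈ Metric.ball p (R/2) := Metric.mem_ball_self (by positivity)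
  have hsub : Metric.ball p (R/4) ⊆ Metric.ball p (R/2) := Metric.ball_subset_ball (by linarith)
  have := intervalIntegral.hasFDerivAt_integral_of_dominated_of_fderiv_le (μ := MeasureTheory.volume)
    (F := Φ) (a := 0) (b := 2 * Real.pi)
    (F' := fun z θ => Complex.I • ((circleMap w R θ - z i)⁻¹ •
          (fderiv ℂ f (Function.update z i (circleMap w R θ))).comp (killCoord i)
        + f (Function.update z i (circleMap w R θ)) •
          ((((circleMap w R θ - z i)^2)⁻¹) • (ContinuousLinearMap.proj i))))
    (bound := fun _ => (2 * ((R/2)⁻¹ * C)) / (R/4))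
    (s := Metric.ball p (R/4)) (x₀ := p) (Metric.ball_mem_nhds _ (by positivity))
    (by
      filter_upwards [Metric.ball_mem_nhds p (show 0 < R/2 by positivity)] with z hz
      exact (hcont z hz).aestronglyMeasurable)
    ((hcont p hp2).intervalIntegrable _ _)
    (by
      have h1 : Continuous (fun θ => Function.update p i (circleMap w R θ)) :=
        (differentiable_update_right i p).continuous.comp (continuous_circleMap w R)
      have h2 : Continuous (fun θ => f (Function.update p i (circleMap w R θ))) :=
        (hf.continuousOn.comp_continuous h1 fun θ => hball (hu p hp2 θ))
      have h3 : Continuous (fun θ => (circleMap w R θ - p i)) :=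
        (continuous_circleMap w R).sub continuous_const
      have h4 : MeasureTheory.StronglyMeasurable
          (fun θ => fderiv ℂ f (Function.update p i (circleMap w R θ))) :=
        ((measurable_fderiv ℂ f).comp h1.measurable).stronglyMeasurable
      have h5 : MeasureTheory.StronglyMeasurable
          (fun θ => (fderiv ℂ f (Function.update p i (circleMap w R θ))).comp (killCoord i)) :=
        (((ContinuousLinearMap.compL ℂ (Fin N → ℂ) (Fin N → ℂ) ℂ).flip
          (killCoord i)).continuous).comp_stronglyMeasurable h4
      have h6 : Continuous (fun θ => (circleMap w R θ - p i)⁻¹) := h3.inv₀ (hden0 p hp2)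
      have h7 : Continuous (fun θ => ((circleMap w R θ - p i)^2)⁻¹) :=
        (h3.pow 2).inv₀ fun θ => pow_ne_zero _ (hden0 p hp2 θ)
      refine MeasureTheory.StronglyMeasurable.aestronglyMeasurable ?_
      refine MeasureTheory.StronglyMeasurable.fun_const_smul ?_ _
      refine MeasureTheory.StronglyMeasurable.fun_add ?_ ?_
      · exact h6.stronglyMeasurable.smul h5
      · exact (h2.smul (h7.smul continuous_const)).stronglyMeasurable)
    (by
      refine Filter.Eventually.of_forall fun θ _ x hx => ?_
      have hx' : Metric.ball x (R/4) ⊆ Metric.ball p (R/2) := by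
        intro z hz
        rw [Metric.mem_ball] at *
        linarith [dist_triangle z x p]
      rw [← (hd x (hsub hx) θ).fderiv]
      refine Complex.norm_fderiv_le_div_of_mapsTo_ball
        (fun z hz => (hd z (hx' hz) θ).differentiableAt.differentiableWithinAt) ?_ (by positivity)
      intro z hz
      rw [Metric.mem_closedBall, dist_eq_norm]
      refine (norm_sub_le _ _).trans ?_
      linarith [hΦb z (hx' hz) θ, hΦb x (hsub hx) θ])
    intervalIntegrable_const
    (by
      refine Filter.Eventually.of_forall fun θ _ x hx => hd x (hsub hx) θ)
  exact this.differentiableAt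

lemma division {N : ℕ} (i : Fin N) (w : ℂ) (Ω : Set (Fin N → ℂ)) (hΩ : IsOpen Ω)
    (f : (Fin N → ℂ) → ℂ) (hf : DifferentiableOn ℂ f Ω) 
    (hup : ∀ z ∈ Ω, Function.update z i w ∈ Ω) (h0 : ∀ z ∈ Ω, f (Function.update z i w) = 0) :
    ∃ D : (Fin N → ℂ) → ℂ, DifferentiableOn ℂ D Ω ∧ ∀ z ∈ Ω, f z = (z i - w) * D z := by
  refine ⟨fun z => dslope (fun ζ => f (Function.update z i ζ)) w (z i), ?_, ?_⟩
  · intro p hpΩ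
    apply DifferentiableAt.differentiableWithinAt
    by_cases hp : p i = w
    · obtain ⟨R, hR, hball⟩ := Metric.nhds_basis_closedBall.mem_iff.1 (hΩ.mem_nhds hpΩ)
      have h1 := (division_aux i w p hp R hR Ω hΩ hball f hf).const_mul ((2 * Real.pi * Complex.I)⁻¹)
      refine h1.congr_of_eventuallyEq ?_
      filter_upwards [Metric.ball_mem_nhds p hR] with z hz
      have hu : ∀ ζ ∈ Metric.closedBall w R, Function.update z i ζ ∈ Ω := by
        intro ζ hζ
        apply hball
        rw [Metric.mem_closedBall, dist_pi_le_iff hR.le]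
        intro j
        by_cases h : j = i
        · subst h
          simpa [hp] using hζ
        · rw [Function.update_of_ne h]
          exact (dist_le_pi_dist z p j).trans (Metric.mem_ball.1 hz).le
      have hV : IsOpen ((fun ζ => Function.update z i ζ) ⁻¹' Ω) :=
        hΩ.preimage (differentiable_update_right i z).continuous
      have hdφ : DifferentiableOn ℂ (fun ζ => f (Function.update z i ζ))
          ((fun ζ => Function.update z i ζ) ⁻¹' Ω) :=
        hf.comp (differentiable_update_right i z).differentiableOn fun ζ hζ => hζ
      have hw : w ∈ (fun ζ => Function.update z i ζ) ⁻¹' Ω :=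
        hu w (Metric.mem_closedBall_self hR.le)
      have hds := (Complex.differentiableOn_dslope (hV.mem_nhds hw)).2 hdφ
      have hzi : z i ∈ Metric.ball w R := by
        rw [← hp]
        exact (dist_le_pi_dist z p i).trans_lt hz
      have hcau := (hds.mono hu).circleIntegral_sub_inv_smul hzi
      have hpi : (2 * Real.pi * Complex.I : ℂ) ≠ 0 := by simp [Real.pi_ne_zero]
      rw [eq_inv_mul_iff_mul_eq₀ hpi, ← smul_eq_mul, ← hcau, circleIntegral]
      refine intervalIntegral.integral_congr fun θ _ => ?_
      have hne : circleMap w R θ - w ≠ 0 := by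
        simp [sub_ne_zero, circleMap_ne_center hR.ne']
      have hfw : f (Function.update z i w) = 0 := by
        have := h0 _ hw
        rwa [Function.update_idem] at this
      rw [dslope_of_ne _ (sub_ne_zero.1 hne), slope_def_field, hfw, deriv_circleMap]
      have : circleMap 0 R θ = circleMap w R θ - w := by simp
      rw [this, smul_eq_mul, smul_eq_mul]
      field_simp
      ring
    · have h1 : DifferentiableAt ℂ (fun z : Fin N → ℂ => f z * (z i - w)⁻¹) p := by
        refine (hf.differentiableAt (hΩ.mem_nhds hpΩ)).fun_mul
          (DifferentiableAt.fun_inv ?_ (sub_ne_zero.2 hp))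
        fun_prop
      refine h1.congr_of_eventuallyEq ?_
      have h2 : ∀ᶠ z : Fin N → ℂ in nhds p, z i ≠ w :=
        (continuous_apply i).continuousAt.eventually_ne hp
      filter_upwards [h2, hΩ.mem_nhds hpΩ] with z hz hzΩ
      rw [dslope_of_ne _ hz, slope_def_field, h0 z hzΩ, Function.update_eq_self, sub_zero,
        div_eq_mul_inv]
  · intro z hz
    by_cases hzw : z i = w
    · have := h0 z hz
      rw [← hzw, Function.update_eq_self] at this
      simp [this, hzw]
    · simp only
      rw [dslope_of_ne _ hzw, slope_def_field, h0 z hz, Function.update_eq_self, sub_zero,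
        mul_div_cancel₀ _ (sub_ne_zero.2 hzw)]
lemma isOpen_annulus (ε : ℝ) : IsOpen (annulus ε) :=
  (isOpen_lt continuous_const continuous_norm).inter (isOpen_lt continuous_norm continuous_const)

lemma isOpen_polySet {N : ℕ} {S : Set ℂ} (hS : IsOpen S) : IsOpen {z : Fin N → ℂ | ∀ i, z i ∈ S} := by
  have : {z : Fin N → ℂ | ∀ i, z i ∈ S} = Set.pi Set.univ fun _ => S := by
    ext z; simp
  rw [this]
  exact isOpen_set_pi Set.finite_univ fun _ _ => hS

lemma isCompact_polySet {N : ℕ} {S : Set ℂ} (hS : IsCompact S) :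
    IsCompact {z : Fin N → ℂ | ∀ i, z i ∈ S} := by
  have : {z : Fin N → ℂ | ∀ i, z i ∈ S} = Set.pi Set.univ fun _ => S := by
    ext z; simp
  rw [this]
  exact isCompact_univ_pi fun _ => hS

lemma isOpen_polyAnnulus (ε : ℝ) (N : ℕ) : IsOpen (polyAnnulus ε N) :=
  isOpen_polySet (isOpen_annulus ε)

lemma update_mem_polyAnnulus {ε : ℝ} {N : ℕ} {z : Fin N → ℂ} (hz : z ∈ polyAnnulus ε N) (i : Fin N)
    {c : ℂ} (hc : c ∈ annulus ε) : Function.update z i c ∈ polyAnnulus ε N := by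
  intro j
  by_cases h : j = i
  · subst h; simpa using hc
  · rw [Function.update_of_ne h]; exact hz j

lemma isPreconnected_annulus (ε : ℝ) (hε : 0 < ε) : IsPreconnected (annulus ε) := by
  have : annulus ε = (fun x : ℝ × ℝ => (x.1 : ℂ) * Complex.exp (x.2 * Complex.I)) ''
      (Set.Ioo (1 - ε) (1 + ε) ×ˢ Set.univ) := by
    ext z
    constructor
    · intro hz
      exact ⟨(‖z‖, Complex.arg z), ⟨⟨hz.1, hz.2⟩, trivial⟩, Complex.norm_mul_exp_arg_mul_I z⟩
    · rintro ⟨⟨r, θ⟩, ⟨⟨h1, h2⟩, -⟩, rfl⟩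
      simp only at h1 h2
      have : ‖(r : ℂ) * Complex.exp (θ * Complex.I)‖ = |r| := by
        rw [norm_mul, Complex.norm_exp_ofReal_mul_I, mul_one, Complex.norm_real, Real.norm_eq_abs]
      simp only [annulus, Set.mem_ofPred_eq, this]
      exact ⟨h1.trans_le (le_abs_self r), abs_lt.2 ⟨by linarith, h2⟩⟩
  rw [this]
  refine IsPreconnected.image (isPreconnected_Ioo.prod isPreconnected_univ) _ ?_
  exact Continuous.continuousOn (by fun_prop)

lemma eventually_ne_zero {ε : ℝ} (hε : 0 < ε) {g : ℂ → ℂ} (hg : DifferentiableOn ℂ g (annulus ε))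
    (hg0 : ∃ z ∈ annulus ε, g z ≠ 0) {z₀ : ℂ} (hz₀ : z₀ ∈ annulus ε) :
    ∀ᶠ z in nhdsWithin z₀ {z₀}ᶜ, g z ≠ 0 := by
  by_contra h
  rw [Filter.not_eventually] at h
  have h' : ∃ᶠ z in nhdsWithin z₀ {z₀}ᶜ, g z = 0 := h.mono fun z hz => not_not.1 hz
  have := (hg.analyticOnNhd (isOpen_annulus ε)).eqOn_zero_of_preconnected_of_frequently_eq_zero
    (isPreconnected_annulus ε hε) hz₀ h'
  obtain ⟨z, hz, hz0⟩ := hg0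
  exact hz0 (this hz)

lemma density {ε : ℝ} (hε : 0 < ε) {g : ℂ → ℂ} (hg : DifferentiableOn ℂ g (annulus ε))
    (hg0 : ∃ z ∈ annulus ε, g z ≠ 0) {N : ℕ} (i : Fin N) (φ : (Fin N → ℂ) → ℂ)
    (hφ : ContinuousOn φ (polyAnnulus ε N)) (h : ∀ z ∈ polyAnnulus ε N, g (z i) * φ z = 0) :
    ∀ z ∈ polyAnnulus ε N, φ z = 0 := by
  intro z hz
  have hcu : Continuous (fun c => Function.update z i c) :=
    continuous_const.update i continuous_id
  have h1 : ContinuousAt (fun c => φ (Function.update z i c)) (z i) := by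
    refine ContinuousAt.comp' (f := fun c => Function.update z i c) ?_ hcu.continuousAt
    rw [Function.update_eq_self]
    exact hφ.continuousAt ((isOpen_polyAnnulus ε N).mem_nhds hz)
  have h2 : Filter.Tendsto (fun c => φ (Function.update z i c)) (nhdsWithin (z i) {z i}ᶜ)
      (nhds (φ z)) := by
    have := h1.tendsto.mono_left (nhdsWithin_le_nhds (s := {z i}ᶜ))
    rwa [Function.update_eq_self] at this
  have h3 : ∀ᶠ c in nhdsWithin (z i) {z i}ᶜ, φ (Function.update z i c) = 0 := by
    filter_upwards [eventually_ne_zero hε hg hg0 (hz i),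
      nhdsWithin_le_nhds ((isOpen_annulus ε).mem_nhds (hz i))] with c hc hcA
    have := h _ (update_mem_polyAnnulus hz i hcA)
    rw [Function.update_self] at this
    exact (mul_eq_zero.1 this).resolve_left hc
  exact tendsto_nhds_unique h2 (tendsto_const_nhds.congr' (h3.mono fun c hc => hc.symm))

lemma finite_zeros {ε : ℝ} (hε : 0 < ε) {g : ℂ → ℂ} (hg : DifferentiableOn ℂ g (annulus ε))
    (hg0 : ∃ z ∈ annulus ε, g z ≠ 0) {K : Set ℂ} (hK : IsCompact K) (hKA : K ⊆ annulus ε) :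
    {z ∈ K | g z = 0}.Finite := by
  by_contra h
  obtain ⟨x, hxK, hx⟩ := Set.Infinite.exists_accPt_of_subset_isCompact h hK (fun z hz => hz.1)
  have h1 := eventually_ne_zero hε hg hg0 (hKA hxK)
  rw [accPt_iff_frequently_nhdsNE] at hx
  obtain ⟨y, hy1, hy2⟩ := (hx.and_eventually h1).exists
  exact hy2 hy1.2

lemma factor_one {ε : ℝ} (hε : 0 < ε) {g : ℂ → ℂ} (hg : DifferentiableOn ℂ g (annulus ε))
    (hg0 : ∃ z ∈ annulus ε, g z ≠ 0) {w : ℂ} (hw : w ∈ annulus ε) :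
    ∃ (n : ℕ) (k : ℂ → ℂ), DifferentiableOn ℂ k (annulus ε) ∧ k w ≠ 0 ∧
      ∀ z ∈ annulus ε, g z = (z - w)^n * k z := by
  have han : AnalyticAt ℂ g w := hg.analyticAt ((isOpen_annulus ε).mem_nhds hw)
  obtain ⟨n, k, hk, hkw, hgk⟩ := (han.exists_eventuallyEq_pow_smul_nonzero_iff).2 (by
    intro h
    have h1 := eventually_ne_zero hε hg hg0 hw
    obtain ⟨y, hy1, hy2⟩ := (h1.and (nhdsWithin_le_nhds h)).exists
    exact hy1 hy2)
  refine ⟨n, fun z => if z = w then k w else g z / (z - w)^n, ?_, ?_, ?_⟩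
  · intro z hz
    apply DifferentiableAt.differentiableWithinAt
    by_cases h : z = w
    · subst h
      refine hk.differentiableAt.congr_of_eventuallyEq ?_
      filter_upwards [hgk] with y hy
      by_cases hyz : y = z
      · simp [hyz]
      · rw [if_neg hyz, hy, smul_eq_mul, mul_div_cancel_left₀]
        exact pow_ne_zero _ (sub_ne_zero.2 hyz)
    · have h1 : DifferentiableAt ℂ (fun z => g z / (z - w)^n) z :=
        (hg.differentiableAt ((isOpen_annulus ε).mem_nhds hz)).fun_div (by fun_prop)
          (pow_ne_zero _ (sub_ne_zero.2 h))
      refine h1.congr_of_eventuallyEq ?_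
      filter_upwards [eventually_ne_nhds h] with y hy
      rw [if_neg hy]
  · simpa using hkw
  · intro z hz
    by_cases h : z = w
    · subst h
      simpa using hgk.self_of_nhds
    · simp only [if_neg h]
      rw [mul_div_cancel₀]
      exact pow_ne_zero _ (sub_ne_zero.2 h)

lemma factor_all {ε : ℝ} (hε : 0 < ε) {K : Set ℂ} (hKA : K ⊆ annulus ε) (Z : Finset ℂ) :
    ∀ {g : ℂ → ℂ} (_ : DifferentiableOn ℂ g (annulus ε))
    (_ : ∃ z ∈ annulus ε, g z ≠ 0) (_ : ∀ z ∈ K, g z = 0 → z ∈ Z),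
    ∃ (L : List ℂ) (k : ℂ → ℂ), (∀ w ∈ L, w ∈ annulus ε) ∧
      DifferentiableOn ℂ k (annulus ε) ∧ (∀ z ∈ K, k z ≠ 0) ∧
      ∀ z ∈ annulus ε, g z = (L.map fun w => z - w).prod * k z := by
  classical
  induction Z using Finset.induction_on with
  | empty =>
    intro g hg hg0 hZ
    exact ⟨[], g, by simp, hg, fun z hz h => by simpa using hZ z hz h, by simp⟩
  | insert w Z hwZ ih =>
    intro g hg hg0 hZ
    by_cases hw : w ∈ annulus ε
    · obtain ⟨n, k, hk, hkw, hgk⟩ := factor_one hε hg hg0 hw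
      obtain ⟨L, k', hL, hk', hkK, hkk⟩ := ih hk ⟨w, hw, hkw⟩ (by
        intro z hz hkz
        have h1 : g z = 0 := by rw [hgk z (hKA hz), hkz, mul_zero]
        rcases Finset.mem_insert.1 (hZ z hz h1) with h | h
        · subst h; exact absurd hkz hkw
        · exact h)
      refine ⟨List.replicate n w ++ L, k', ?_, hk', hkK, ?_⟩
      · intro x hx
        rcases List.mem_append.1 hx with h | h
        · rw [List.eq_of_mem_replicate h]; exact hw
        · exact hL x h
      · intro z hz
        rw [hgk z hz, hkk z hz]
        simp [mul_assoc]
    · refine ih hg hg0 fun z hz h => ?_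
      rcases Finset.mem_insert.1 (hZ z hz h) with h | h
      · subst h; exact absurd (hKA hz) hw
      · exact h

lemma exhaustion (ε : ℝ) (hε : 0 < ε) : ∃ U K : ℕ → Set ℂ, (∀ n, IsOpen (U n)) ∧ Monotone U ∧
    (∀ z ∈ annulus ε, ∃ n, z ∈ U n) ∧ (∀ n, U n ⊆ K n) ∧ (∀ n, IsCompact (K n)) ∧
    (∀ n, K n ⊆ annulus ε) ∧
    ∀ n, ∀ w ∈ annulus ε, w ∉ K n → ∀ δ > 0, ∃ q : ℂ → ℂ, DifferentiableOn ℂ q (annulus ε) ∧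
      q w = 1 ∧ ∀ z ∈ K n, ‖q z‖ ≤ δ := by
  set d : ℕ → ℝ := fun n => ε / (n + 2) with hd
  have hdpos : ∀ n, 0 < d n := fun n => by positivity
  have hdanti : Antitone d := by
    intro m n hmn
    simp only [hd]
    gcongr
  have hdlim : Filter.Tendsto d Filter.atTop (nhds 0) := by
    have h2 : Filter.Tendsto (fun n : ℕ => (n : ℝ) + 2) Filter.atTop Filter.atTop :=
      Filter.tendsto_atTop_add_const_right _ _ tendsto_natCast_atTop_atTop
    exact h2.const_div_atTop ε
  set a : ℕ → ℝ := fun n => if 1 < ε then -1 else 1 - ε + d n with ha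
  have hanti : Antitone a := by
    intro m n hmn
    simp only [ha]
    split_ifs
    · exact le_rfl
    · linarith [hdanti hmn]
  refine ⟨fun n => {z | a n < ‖z‖ ∧ ‖z‖ < 1 + ε - d n}, fun n => {z | a n ≤ ‖z‖ ∧ ‖z‖ ≤ 1 + ε - d n},
    ?_, ?_, ?_, ?_, ?_, ?_, ?_⟩
  · exact fun n => (isOpen_lt continuous_const continuous_norm).inter
      (isOpen_lt continuous_norm continuous_const)
  · rintro m n hmn z ⟨h1, h2⟩
    exact ⟨(hanti hmn).trans_lt h1, h2.trans_le (by linarith [hdanti hmn])⟩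
  · rintro z ⟨h1, h2⟩
    have e1 : ∀ᶠ n in Filter.atTop, d n < ‖z‖ - (1 - ε) :=
      hdlim.eventually_lt_const (by linarith)
    have e2 : ∀ᶠ n in Filter.atTop, d n < 1 + ε - ‖z‖ :=
      hdlim.eventually_lt_const (by linarith)
    obtain ⟨n, hn1, hn2⟩ := (e1.and e2).exists
    refine ⟨n, ?_, by linarith⟩
    simp only [ha]
    split_ifs
    · linarith [norm_nonneg z]
    · linarith
  · rintro n z ⟨h1, h2⟩
    exact ⟨h1.le, h2.le⟩
  · intro n
    refine Metric.isCompact_of_isClosed_isBounded ?_ ?_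
    · exact (isClosed_le continuous_const continuous_norm).inter
        (isClosed_le continuous_norm continuous_const)
    · refine (Metric.isBounded_closedBall (x := (0:ℂ)) (r := 1 + ε - d n)).subset ?_
      rintro z ⟨-, h⟩
      simpa using h
  · rintro n z ⟨h1, h2⟩
    refine ⟨?_, by linarith [hdpos n]⟩
    simp only [ha] at h1
    split_ifs at h1
    · linarith [norm_nonneg z]
    · linarith [hdpos n]
  · intro n w hw hwK δ hδ
    have hdle : d n ≤ ε / 2 := by
      simp only [hd]
      gcongr
      linarith [(Nat.cast_nonneg n : (0:ℝ) ≤ n)]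
    by_cases hout : 1 + ε - d n < ‖w‖
    · have hb : 0 < 1 + ε - d n := by linarith
      have hwpos : 0 < ‖w‖ := hb.trans hout
      have hw0 : w ≠ 0 := norm_pos_iff.1 hwpos
      obtain ⟨m, hm⟩ := exists_pow_lt_of_lt_one hδ (show (1 + ε - d n) / ‖w‖ < 1 by
        rwa [div_lt_one hwpos])
      refine ⟨fun z => (z / w)^m, by fun_prop, by simp [hw0], ?_⟩
      rintro z ⟨-, hz⟩
      rw [norm_pow, norm_div]
      refine le_trans ?_ hm.le
      gcongr
    · have hin : ‖w‖ < a n := by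
        by_contra h
        exact hwK ⟨not_lt.1 h, not_lt.1 hout⟩
      have hε1 : ¬ 1 < ε := by
        intro h
        simp only [ha, if_pos h] at hin
        linarith [norm_nonneg w]
      have hapos : 0 < a n := (norm_nonneg w).trans_lt hin
      have h0 : ∀ z ∈ annulus ε, z ≠ 0 := by
        rintro z ⟨hz, -⟩ rfl
        rw [norm_zero] at hz
        linarith
      obtain ⟨m, hm⟩ := exists_pow_lt_of_lt_one hδ (show ‖w‖ / a n < 1 by
        rwa [div_lt_one hapos])
      refine ⟨fun z => (w / z)^m, ?_, by simp [h0 w hw], ?_⟩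
      · intro z hz
        exact (DifferentiableAt.fun_pow ((differentiableAt_const w).fun_div differentiableAt_id (h0 z hz)) m).differentiableWithinAt
      · rintro z ⟨hz, -⟩
        rw [norm_pow, norm_div]
        refine le_trans ?_ hm.le
        gcongr
/-- The linear equation over `Fin M` (with coordinates selected by `σ`) is solvable. -/
def Solvable (ε : ℝ) (g : ℂ → ℂ) {M N : ℕ} (σ : Fin M → Fin N) : Prop :=
  ∀ A : Fin M → (Fin N → ℂ) → ℂ, (∀ a, DifferentiableOn ℂ (A a) (polyAnnulus ε N)) →
    (∀ z ∈ polyAnnulus ε N, ∑ a, A a z * g (z (σ a)) = 0) →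
    ∃ B : Fin M → Fin M → (Fin N → ℂ) → ℂ,
      (∀ a b, DifferentiableOn ℂ (B a b) (polyAnnulus ε N)) ∧
      (∀ a b, ∀ z ∈ polyAnnulus ε N, B a b z = -B b a z) ∧
      (∀ a, ∀ z ∈ polyAnnulus ε N, A a z = ∑ b, B a b z * g (z (σ b)))

/-- A partial solution: the remainder is divisible by `p (z i)`, where `g = p * h`. -/
structure PartialSol (ε : ℝ) (g : ℂ → ℂ) {M N : ℕ} (σ : Fin M → Fin N) (i : Fin N)
    (A : Fin M → (Fin N → ℂ) → ℂ) where
  p : ℂ → ℂ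
  h : ℂ → ℂ
  B : Fin M → Fin M → (Fin N → ℂ) → ℂ
  D : Fin M → (Fin N → ℂ) → ℂ
  hp : DifferentiableOn ℂ p (annulus ε)
  hh : DifferentiableOn ℂ h (annulus ε)
  hB : ∀ a b, DifferentiableOn ℂ (B a b) (polyAnnulus ε N)
  hD : ∀ a, DifferentiableOn ℂ (D a) (polyAnnulus ε N)
  fact : ∀ z ∈ annulus ε, g z = p z * h z
  anti : ∀ a b, ∀ z ∈ polyAnnulus ε N, B a b z = -B b a z
  eqn : ∀ a, ∀ z ∈ polyAnnulus ε N, A a z = ∑ b, B a b z * g (z (σ b)) + p (z i) * D a z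

lemma antisymm_sum {M : ℕ} (B : Fin M → Fin M → ℂ) (x : Fin M → ℂ) (h : ∀ a b, B a b = - B b a) :
    ∑ a, (∑ b, B a b * x b) * x a = 0 := by
  have h1 : ∑ a, (∑ b, B a b * x b) * x a = ∑ a, ∑ b, B a b * x b * x a := by
    simp_rw [Finset.sum_mul]
  have h2 : ∑ a, ∑ b, B a b * x b * x a = - ∑ a, ∑ b, B a b * x b * x a := by
    conv_lhs => rw [Finset.sum_comm]
    rw [← Finset.sum_neg_distrib]
    refine Finset.sum_congr rfl fun a _ => ?_
    rw [← Finset.sum_neg_distrib]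
    refine Finset.sum_congr rfl fun b _ => ?_
    rw [h b a]; ring
  rw [h1]
  exact self_eq_neg.1 h2

lemma comp_coord {ε : ℝ} {N : ℕ} (i : Fin N) {q : ℂ → ℂ} (hq : DifferentiableOn ℂ q (annulus ε)) :
    DifferentiableOn ℂ (fun z : Fin N → ℂ => q (z i)) (polyAnnulus ε N) :=
  hq.comp (by fun_prop) fun z hz => hz i

/-- Sup bounds for finitely many continuous functions on a compact set. -/
lemma common_bound {ι X : Type*} [Finite ι] [TopologicalSpace X] {K : Set X} (hK : IsCompact K)
    (F : ι → X → ℂ) (hF : ∀ j, ContinuousOn (F j) K) :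
    ∃ C : ℝ, 0 < C ∧ ∀ j, ∀ x ∈ K, ‖F j x‖ ≤ C := by
  have : ∀ j, ∃ C : ℝ, ∀ x ∈ K, ‖F j x‖ ≤ C := fun j => hK.exists_bound_of_continuousOn (hF j)
  choose C hC using this
  obtain ⟨C', hC'⟩ := Finite.bddAbove_range C
  refine ⟨max C' 1, by positivity, fun j x hx => ?_⟩
  exact ((hC j x hx).trans (hC' ⟨j, rfl⟩)).trans (le_max_left _ _)

lemma one_zero {ε : ℝ} (hε : 0 < ε) {g : ℂ → ℂ} (hg : DifferentiableOn ℂ g (annulus ε))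
    (hg0 : ∃ z ∈ annulus ε, g z ≠ 0) {M N : ℕ} (σ : Fin M → Fin N) (i : Fin N)
    (hσ : ∀ a, σ a ≠ i) (IH : Solvable ε g σ) (A : Fin M → (Fin N → ℂ) → ℂ)
    (Al : (Fin N → ℂ) → ℂ) (hAl : DifferentiableOn ℂ Al (polyAnnulus ε N))
    (heq : ∀ z ∈ polyAnnulus ε N, ∑ a, A a z * g (z (σ a)) + Al z * g (z i) = 0)
    (K : Set ℂ) (hK : IsCompact K) (hKA : K ⊆ annulus ε)
    (hq : ∀ w ∈ annulus ε, w ∉ K → ∀ δ > 0, ∃ q : ℂ → ℂ, DifferentiableOn ℂ q (annulus ε) ∧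
      q w = 1 ∧ ∀ z ∈ K, ‖q z‖ ≤ δ)
    (s : PartialSol ε g σ i A) (hs : ∀ z ∈ K, s.h z ≠ 0) (w : ℂ) (hw : w ∈ annulus ε)
    (hsw : s.h w = 0) (δ : ℝ) (hδ : 0 < δ) :
    ∃ s' : PartialSol ε g σ i A, (∀ z ∈ annulus ε, s.h z = (z - w) * s'.h z) ∧
      (∀ a b, ∀ z : Fin N → ℂ, (∀ j, z j ∈ K) → ‖s'.B a b z - s.B a b z‖ ≤ δ) ∧
      (∀ a, ∀ z : Fin N → ℂ, (∀ j, z j ∈ K) →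
        ‖s'.D a z / s'.h (z i) - s.D a z / s.h (z i)‖ ≤ δ) := by
  have hΩ := isOpen_polyAnnulus ε N
  have hwK : w ∉ K := fun h => hs w h hsw
  -- the remainder equation
  have hrem : ∀ z ∈ polyAnnulus ε N, ∑ a, s.D a z * g (z (σ a)) + Al z * s.h (z i) = 0 := by
    refine density hε hg hg0 i _ ?_ ?_
    · refine DifferentiableOn.continuousOn (𝕜 := ℂ) ?_
      refine DifferentiableOn.fun_add (DifferentiableOn.fun_sum fun a _ => ?_) ?_
      · exact (s.hD a).fun_mul (comp_coord (σ a) hg)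
      · exact hAl.fun_mul (comp_coord i s.hh)
    · intro z hz
      have h1 := heq z hz
      have h2 := antisymm_sum (fun a b => s.B a b z) (fun b => g (z (σ b)))
        (fun a b => s.anti a b z hz)
      have h3 : ∑ a, A a z * g (z (σ a)) = s.p (z i) * ∑ a, s.D a z * g (z (σ a)) := by
        have : ∀ a, A a z * g (z (σ a)) = (∑ b, s.B a b z * g (z (σ b))) * g (z (σ a)) +
            s.p (z i) * (s.D a z * g (z (σ a))) := fun a => by rw [s.eqn a z hz]; ring
        simp_rw [this]
        rw [Finset.sum_add_distrib, h2, zero_add, Finset.mul_sum]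
      rw [h3] at h1
      have h4 := s.fact _ (hz i)
      rw [h4] at h1 ⊢
      linear_combination s.h (z i) * h1
  -- restriction to `z i = w`
  set Dw : Fin M → (Fin N → ℂ) → ℂ := fun a z => s.D a (Function.update z i w) with hDw
  have hDwd : ∀ a, DifferentiableOn ℂ (Dw a) (polyAnnulus ε N) := fun a =>
    (s.hD a).comp (fun z _ => (hasFDerivAt_update_left i z w).differentiableAt.differentiableWithinAt)
      fun z hz => update_mem_polyAnnulus hz i hw
  obtain ⟨E, hEd, hEa, hE⟩ := IH Dw hDwd (by
    intro z hz
    have := hrem _ (update_mem_polyAnnulus hz i hw)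
    rw [Function.update_self, hsw, mul_zero, add_zero] at this
    rw [← this]
    refine Finset.sum_congr rfl fun a _ => ?_
    rw [Function.update_of_ne (hσ a)])
  have hKP : IsCompact {z : Fin N → ℂ | ∀ j, z j ∈ K} := isCompact_polySet hK
  have hKPsub : {z : Fin N → ℂ | ∀ j, z j ∈ K} ⊆ polyAnnulus ε N := fun z hz j => hKA (hz j)
  obtain ⟨C1, hC1, hb1⟩ := common_bound hKP
    (fun (x : Fin M × Fin M) (z : Fin N → ℂ) => s.p (z i) * E x.1 x.2 z) (fun x =>
      (((comp_coord i s.hp).fun_mul (hEd x.1 x.2)).continuousOn).mono hKPsub)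
  obtain ⟨C2, hC2, hb2⟩ := common_bound hKP
    (fun (a : Fin M) (z : Fin N → ℂ) => Dw a z / s.h (z i)) (fun a =>
      ContinuousOn.div ((hDwd a).continuousOn.mono hKPsub)
        ((comp_coord i s.hh).continuousOn.mono hKPsub) fun z hz => hs _ (hz i))
  obtain ⟨q, hqd, hqw, hqb⟩ := hq w hw hwK (δ / (C1 + C2)) (by positivity)
  -- divisions
  have hdiv : ∀ a, ∃ D' : (Fin N → ℂ) → ℂ, DifferentiableOn ℂ D' (polyAnnulus ε N) ∧
      ∀ z ∈ polyAnnulus ε N, s.D a z - q (z i) * Dw a z = (z i - w) * D' z := by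
    intro a
    refine division i w _ hΩ _ ((s.hD a).fun_sub ((comp_coord i hqd).fun_mul (hDwd a)))
      (fun z hz => update_mem_polyAnnulus hz i hw) ?_
    intro z hz
    simp [hDw, hqw]
  choose D' hD'd hD' using hdiv
  have hh' : ∀ z, s.h z = (z - w) * dslope s.h w z := by
    intro z
    have := sub_smul_dslope s.h w z
    rw [hsw, sub_zero, smul_eq_mul] at this
    exact this.symm
  refine ⟨⟨fun z => s.p z * (z - w), dslope s.h w,
    fun a b z => s.B a b z + s.p (z i) * q (z i) * E a b z, D', ?_, ?_, ?_, hD'd, ?_, ?_, ?_⟩,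
    fun z _ => hh' z, ?_, ?_⟩
  · exact s.hp.fun_mul (by fun_prop)
  · exact (Complex.differentiableOn_dslope ((isOpen_annulus ε).mem_nhds hw)).2 s.hh
  · exact fun a b => (s.hB a b).fun_add
      (((comp_coord i s.hp).fun_mul (comp_coord i hqd)).fun_mul (hEd a b))
  · intro z hz
    rw [s.fact z hz, hh' z]; ring
  · intro a b z hz
    rw [s.anti a b z hz, hEa a b z hz]; ring
  · intro a z hz
    have h1 := hE a z hz
    have h2 : ∑ b, (s.B a b z + s.p (z i) * q (z i) * E a b z) * g (z (σ b)) =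
        ∑ b, s.B a b z * g (z (σ b)) + s.p (z i) * q (z i) * ∑ b, E a b z * g (z (σ b)) := by
      rw [Finset.mul_sum, ← Finset.sum_add_distrib]
      exact Finset.sum_congr rfl fun b _ => by ring
    rw [h2, ← h1, s.eqn a z hz]
    linear_combination s.p (z i) * hD' a z hz
  · intro a b z hz
    have h1 := hb1 (a, b) z hz
    have h2 := hqb _ (hz i)
    have h3 : s.B a b z + s.p (z i) * q (z i) * E a b z - s.B a b z =
      q (z i) * (s.p (z i) * E a b z) := by ring
    simp only at h1 ⊢
    rw [h3, norm_mul]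
    calc _ ≤ δ / (C1 + C2) * C1 := by gcongr
      _ ≤ δ := by
        rw [div_mul_eq_mul_div, div_le_iff₀ (by positivity)]
        nlinarith
  · intro a z hz
    have h1 := hb2 a z hz
    have h2 := hqb _ (hz i)
    have hzi : z i - w ≠ 0 := sub_ne_zero.2 fun h => hwK (h ▸ hz i)
    have hhz := hs _ (hz i)
    have hdz : dslope s.h w (z i) ≠ 0 := fun h => hhz (by rw [hh', h, mul_zero])
    have h3 : D' a z / dslope s.h w (z i) - s.D a z / s.h (z i) =
        - (q (z i) * (Dw a z / s.h (z i))) := by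
      have h4 := hD' a z (hKPsub hz)
      rw [hh' (z i)]
      field_simp
      linear_combination -h4
    simp only at h1 ⊢
    rw [h3, norm_neg, norm_mul]
    calc _ ≤ δ / (C1 + C2) * C2 := by gcongr
      _ ≤ δ := by
        rw [div_mul_eq_mul_div, div_le_iff₀ (by positivity)]
        nlinarith

lemma cancel_factor {ε : ℝ} {w : ℂ} {u v : ℂ → ℂ} (hu : ContinuousOn u (annulus ε))
    (hv : ContinuousOn v (annulus ε)) (h : ∀ z ∈ annulus ε, (z - w) * u z = (z - w) * v z) :
    ∀ z ∈ annulus ε, u z = v z := by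
  intro z hz
  by_cases hzw : z = w
  · subst hzw
    have hn := (isOpen_annulus ε).mem_nhds hz
    have h1 := (hu.continuousAt hn).tendsto.mono_left (nhdsWithin_le_nhds (s := {z}ᶜ))
    have h2 := (hv.continuousAt hn).tendsto.mono_left (nhdsWithin_le_nhds (s := {z}ᶜ))
    refine tendsto_nhds_unique h1 (h2.congr' ?_)
    filter_upwards [nhdsWithin_le_nhds hn, self_mem_nhdsWithin] with y hy hyz
    exact (mul_left_cancel₀ (sub_ne_zero.2 hyz) (h y hy)).symm
  · exact mul_left_cancel₀ (sub_ne_zero.2 hzw) (h z hz)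

lemma many_zeros {ε : ℝ} (hε : 0 < ε) {g : ℂ → ℂ} (hg : DifferentiableOn ℂ g (annulus ε))
    (hg0 : ∃ z ∈ annulus ε, g z ≠ 0) {M N : ℕ} (σ : Fin M → Fin N) (i : Fin N)
    (hσ : ∀ a, σ a ≠ i) (IH : Solvable ε g σ) (A : Fin M → (Fin N → ℂ) → ℂ)
    (Al : (Fin N → ℂ) → ℂ) (hAl : DifferentiableOn ℂ Al (polyAnnulus ε N))
    (heq : ∀ z ∈ polyAnnulus ε N, ∑ a, A a z * g (z (σ a)) + Al z * g (z i) = 0)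
    (K : Set ℂ) (hK : IsCompact K) (hKA : K ⊆ annulus ε)
    (hq : ∀ w ∈ annulus ε, w ∉ K → ∀ δ > 0, ∃ q : ℂ → ℂ, DifferentiableOn ℂ q (annulus ε) ∧
      q w = 1 ∧ ∀ z ∈ K, ‖q z‖ ≤ δ) (K' : Set ℂ) (hKA' : K' ⊆ annulus ε)
    (k : ℂ → ℂ) (hk : DifferentiableOn ℂ k (annulus ε)) (hkK : ∀ z ∈ K', k z ≠ 0) (L : List ℂ) :
    ∀ (s : PartialSol ε g σ i A) (_ : ∀ z ∈ K, s.h z ≠ 0)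
    (_ : ∀ w ∈ L, w ∈ annulus ε)
    (_ : ∀ z ∈ annulus ε, s.h z = (L.map fun w => z - w).prod * k z) (δ : ℝ) (_ : 0 < δ),
    ∃ s' : PartialSol ε g σ i A, (∀ z ∈ K', s'.h z ≠ 0) ∧
      (∀ a b, ∀ z : Fin N → ℂ, (∀ j, z j ∈ K) → ‖s'.B a b z - s.B a b z‖ ≤ δ) ∧
      (∀ a, ∀ z : Fin N → ℂ, (∀ j, z j ∈ K) →
        ‖s'.D a z / s'.h (z i) - s.D a z / s.h (z i)‖ ≤ δ) := by
  induction L with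
  | nil =>
    intro s hs hL hsk δ hδ
    refine ⟨s, fun z hz => ?_, ?_, ?_⟩
    · rw [hsk z (hKA' hz)]
      simpa using hkK z hz
    · intro a b z _; simpa using hδ.le
    · intro a z _; simpa using hδ.le
  | cons w L ih =>
    intro s hs hL hsk δ hδ
    have hw : w ∈ annulus ε := hL w (by simp)
    obtain ⟨s₁, h1, h2, h3⟩ := one_zero hε hg hg0 σ i hσ IH A Al hAl heq K hK hKA hq s hs w hw
      (by rw [hsk w hw]; simp) (δ/2) (by positivity)
    have hs1 : ∀ z ∈ annulus ε, s₁.h z = (L.map fun w => z - w).prod * k z := by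
      refine cancel_factor (w := w) s₁.hh.continuousOn ?_ ?_
      · refine ContinuousOn.mul (Continuous.continuousOn ?_) hk.continuousOn
        exact continuous_list_prod L fun x _ => by fun_prop
      · intro z hz
        rw [← h1 z hz, hsk z hz, List.map_cons, List.prod_cons, mul_assoc]
    obtain ⟨s₂, h4, h5, h6⟩ := ih s₁ (fun z hz h => hs z hz (by rw [h1 z (hKA hz), h, mul_zero]))
      (fun x hx => hL x (by simp [hx])) hs1 (δ/2) (by positivity)
    refine ⟨s₂, h4, fun a b z hz => ?_, fun a z hz => ?_⟩
    · have := norm_add_le (s₂.B a b z - s₁.B a b z) (s₁.B a b z - s.B a b z)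
      rw [sub_add_sub_cancel] at this
      linarith [h2 a b z hz, h5 a b z hz]
    · have := norm_add_le (s₂.D a z / s₂.h (z i) - s₁.D a z / s₁.h (z i))
        (s₁.D a z / s₁.h (z i) - s.D a z / s.h (z i))
      rw [sub_add_sub_cancel] at this
      linarith [h3 a z hz, h6 a z hz]

lemma next_step {ε : ℝ} (hε : 0 < ε) {g : ℂ → ℂ} (hg : DifferentiableOn ℂ g (annulus ε))
    (hg0 : ∃ z ∈ annulus ε, g z ≠ 0) {M N : ℕ} (σ : Fin M → Fin N) (i : Fin N)
    (hσ : ∀ a, σ a ≠ i) (IH : Solvable ε g σ) (A : Fin M → (Fin N → ℂ) → ℂ)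
    (Al : (Fin N → ℂ) → ℂ) (hAl : DifferentiableOn ℂ Al (polyAnnulus ε N))
    (heq : ∀ z ∈ polyAnnulus ε N, ∑ a, A a z * g (z (σ a)) + Al z * g (z i) = 0)
    (K : Set ℂ) (hK : IsCompact K) (hKA : K ⊆ annulus ε)
    (hq : ∀ w ∈ annulus ε, w ∉ K → ∀ δ > 0, ∃ q : ℂ → ℂ, DifferentiableOn ℂ q (annulus ε) ∧
      q w = 1 ∧ ∀ z ∈ K, ‖q z‖ ≤ δ) (K' : Set ℂ) (hK' : IsCompact K') (hKA' : K' ⊆ annulus ε)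
    (s : PartialSol ε g σ i A) (hs : ∀ z ∈ K, s.h z ≠ 0) (δ : ℝ) (hδ : 0 < δ) :
    ∃ s' : PartialSol ε g σ i A, (∀ z ∈ K', s'.h z ≠ 0) ∧
      (∀ a b, ∀ z : Fin N → ℂ, (∀ j, z j ∈ K) → ‖s'.B a b z - s.B a b z‖ ≤ δ) ∧
      (∀ a, ∀ z : Fin N → ℂ, (∀ j, z j ∈ K) →
        ‖s'.D a z / s'.h (z i) - s.D a z / s.h (z i)‖ ≤ δ) := by
  have hh0 : ∃ z ∈ annulus ε, s.h z ≠ 0 := by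
    obtain ⟨z, hz, hgz⟩ := hg0
    exact ⟨z, hz, fun h => hgz (by rw [s.fact z hz, h, mul_zero])⟩
  obtain ⟨L, k, hL, hk, hkK, hsk⟩ := factor_all hε hKA' (finite_zeros hε s.hh hh0 hK' hKA').toFinset
    s.hh hh0 (fun z hz h => by simpa using ⟨hz, h⟩)
  exact many_zeros hε hg hg0 σ i hσ IH A Al hAl heq K hK hKA hq K' hKA' k hk hkK L s hs hL hsk δ hδ

/-- Splitting off the coordinate `i`. -/
lemma split_off {ε : ℝ} (hε : 0 < ε) {g : ℂ → ℂ} (hg : DifferentiableOn ℂ g (annulus ε))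
    (hg0 : ∃ z ∈ annulus ε, g z ≠ 0) {M N : ℕ} (σ : Fin M → Fin N) (i : Fin N)
    (hσ : ∀ a, σ a ≠ i) (IH : Solvable ε g σ) (A : Fin M → (Fin N → ℂ) → ℂ)
    (hA : ∀ a, DifferentiableOn ℂ (A a) (polyAnnulus ε N))
    (Al : (Fin N → ℂ) → ℂ) (hAl : DifferentiableOn ℂ Al (polyAnnulus ε N))
    (heq : ∀ z ∈ polyAnnulus ε N, ∑ a, A a z * g (z (σ a)) + Al z * g (z i) = 0) :
    ∃ (B : Fin M → Fin M → (Fin N → ℂ) → ℂ) (C : Fin M → (Fin N → ℂ) → ℂ),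
      (∀ a b, DifferentiableOn ℂ (B a b) (polyAnnulus ε N)) ∧
      (∀ a, DifferentiableOn ℂ (C a) (polyAnnulus ε N)) ∧
      (∀ a b, ∀ z ∈ polyAnnulus ε N, B a b z = -B b a z) ∧
      (∀ a, ∀ z ∈ polyAnnulus ε N, A a z = ∑ b, B a b z * g (z (σ b)) + C a z * g (z i)) := by
  obtain ⟨U, K, hUo, hUm, hUA, hUK, hK, hKA, hq⟩ := exhaustion ε hε
  let s₀ : PartialSol ε g σ i A := ⟨fun _ => 1, g, fun _ _ _ => 0, A, by fun_prop, hg,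
    fun _ _ => by fun_prop, hA, by simp, by simp, by simp⟩
  obtain ⟨t₀, ht₀, -⟩ := next_step hε hg hg0 σ i hσ IH A Al hAl heq ∅ isCompact_empty (by simp)
    (fun w _ _ δ _ => ⟨fun _ => 1, by fun_prop, rfl, by simp⟩) (K 0) (hK 0) (hKA 0) s₀ (by simp)
    1 one_pos
  have step : ∀ n, ∀ s : {s : PartialSol ε g σ i A // ∀ z ∈ K n, s.h z ≠ 0},
      ∃ s' : {s : PartialSol ε g σ i A // ∀ z ∈ K (n+1), s.h z ≠ 0},
      (∀ a b, ∀ z : Fin N → ℂ, (∀ j, z j ∈ K n) → ‖s'.1.B a b z - s.1.B a b z‖ ≤ (1/2)^n) ∧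
      (∀ a, ∀ z : Fin N → ℂ, (∀ j, z j ∈ K n) →
        ‖s'.1.D a z / s'.1.h (z i) - s.1.D a z / s.1.h (z i)‖ ≤ (1/2)^n) := by
    rintro n ⟨s, hs⟩
    obtain ⟨s', h1, h2, h3⟩ := next_step hε hg hg0 σ i hσ IH A Al hAl heq (K n) (hK n) (hKA n)
      (hq n) (K (n+1)) (hK _) (hKA _) s hs ((1/2)^n) (by positivity)
    exact ⟨⟨s', h1⟩, h2, h3⟩
  choose nxt hnxtB hnxtD using step
  let S : (n : ℕ) → {s : PartialSol ε g σ i A // ∀ z ∈ K n, s.h z ≠ 0} := fun n =>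
    Nat.rec ⟨t₀, ht₀⟩ (fun n s => nxt n s) n
  have hS : ∀ n, S (n+1) = nxt n (S n) := fun n => rfl
  set V : ℕ → Set (Fin N → ℂ) := fun n => {z | ∀ j, z j ∈ U n} with hV
  have hVo : ∀ n, IsOpen (V n) := fun n => isOpen_polySet (hUo n)
  have hVm : Monotone V := fun m n hmn z hz j => hUm hmn (hz j)
  have hVA : ∀ n, V n ⊆ polyAnnulus ε N := fun n z hz j => hKA n (hUK n (hz j))
  have hVU : ⋃ n, V n = polyAnnulus ε N := by
    refine Set.Subset.antisymm (Set.iUnion_subset hVA) fun z hz => ?_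
    choose m hm using fun j => hUA (z j) (hz j)
    obtain ⟨n, hn⟩ := Finite.bddAbove_range m
    exact Set.mem_iUnion.2 ⟨n, fun j => hUm (hn ⟨j, rfl⟩) (hm j)⟩
  have limB : ∀ a b, ∃ f : (Fin N → ℂ) → ℂ, DifferentiableOn ℂ f (⋃ n, V n) ∧
      ∀ z ∈ ⋃ n, V n, Filter.Tendsto (fun n => (S n).1.B a b z) Filter.atTop (nhds (f z)) := by
    intro a b
    refine limit_exists V hVo hVm _ (fun n => ((S n).1.hB a b).mono (hVA n)) ?_
    intro n z hz
    rw [hS]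
    exact hnxtB n (S n) a b z fun j => hUK n (hz j)
  have limD : ∀ a, ∃ f : (Fin N → ℂ) → ℂ, DifferentiableOn ℂ f (⋃ n, V n) ∧
      ∀ z ∈ ⋃ n, V n, Filter.Tendsto (fun n => (S n).1.D a z / (S n).1.h (z i))
        Filter.atTop (nhds (f z)) := by
    intro a
    refine limit_exists V hVo hVm (fun n z => (S n).1.D a z / (S n).1.h (z i)) (fun n => ?_) ?_
    · simp only [div_eq_mul_inv]
      exact (((S n).1.hD a).mono (hVA n)).fun_mul
        (((comp_coord i (S n).1.hh).mono (hVA n)).fun_inv fun z hz => (S n).2 _ (hUK n (hz i)))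
    · intro n z hz
      rw [hS]
      exact hnxtD n (S n) a z fun j => hUK n (hz j)
  rw [hVU] at limB limD
  choose B hBd hB using limB
  choose C hCd hC using limD
  refine ⟨B, C, hBd, hCd, ?_, ?_⟩
  · intro a b z hz
    refine tendsto_nhds_unique (hB a b z hz) ((hB b a z hz).neg.congr fun n => ?_)
    exact ((S n).1.anti a b z hz).symm
  · intro a z hz
    have h1 : Filter.Tendsto (fun n => ∑ b, (S n).1.B a b z * g (z (σ b)) +
        (S n).1.D a z / (S n).1.h (z i) * g (z i)) Filter.atTop
        (nhds (∑ b, B a b z * g (z (σ b)) + C a z * g (z i))) :=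
      (tendsto_finsetSum _ fun b _ => (hB a b z hz).mul_const _).add ((hC a z hz).mul_const _)
    refine tendsto_nhds_unique (tendsto_const_nhds.congr' ?_) h1
    rw [← hVU] at hz
    obtain ⟨m, hm⟩ := Set.mem_iUnion.1 hz
    rw [hVU] at hz
    filter_upwards [Filter.eventually_ge_atTop m] with n hn
    have h2 : (S n).1.h (z i) ≠ 0 := (S n).2 _ (hUK n (hVm hn hm i))
    rw [(S n).1.eqn a z hz, (S n).1.fact _ (hz i)]
    field_simp

lemma solvable_all {ε : ℝ} (hε : 0 < ε) {g : ℂ → ℂ} (hg : DifferentiableOn ℂ g (annulus ε))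
    (hg0 : ∃ z ∈ annulus ε, g z ≠ 0) {N : ℕ} (M : ℕ) :
    ∀ (σ : Fin M → Fin N), Function.Injective σ → Solvable ε g σ := by
  induction M with
  | zero =>
    intro σ _ A hA heq
    exact ⟨fun a => a.elim0, fun a => a.elim0, fun a => a.elim0, fun a => a.elim0⟩
  | succ M ih =>
    intro σ hσ A hA heq
    have hne : ∀ a : Fin M, σ a.castSucc ≠ σ (Fin.last M) := fun a h =>
      absurd (hσ h) (Fin.castSucc_lt_last a).ne
    have heq' : ∀ z ∈ polyAnnulus ε N, ∑ a : Fin M, A a.castSucc z * g (z (σ a.castSucc)) +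
        A (Fin.last M) z * g (z (σ (Fin.last M))) = 0 := by
      intro z hz
      rw [← heq z hz, Fin.sum_univ_castSucc]
    obtain ⟨B, C, hBd, hCd, hBa, hBC⟩ := split_off hε hg hg0 (fun a : Fin M => σ a.castSucc)
      (σ (Fin.last M)) hne (ih _ (hσ.comp (Fin.castSucc_injective M)))
      (fun a => A a.castSucc) (fun a => hA _) (A (Fin.last M)) (hA _) heq'
    have hlast : ∀ z ∈ polyAnnulus ε N,
        A (Fin.last M) z + ∑ a : Fin M, C a z * g (z (σ a.castSucc)) = 0 := by
      refine density hε hg hg0 (σ (Fin.last M)) _ ?_ ?_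
      · refine DifferentiableOn.continuousOn (𝕜 := ℂ) ?_
        exact (hA _).fun_add (DifferentiableOn.fun_sum fun a _ =>
          (hCd a).fun_mul (comp_coord _ hg))
      · intro z hz
        have h1 := heq' z hz
        have h2 := antisymm_sum (fun a b => B a b z) (fun b => g (z (σ b.castSucc)))
          (fun a b => hBa a b z hz)
        have h3 : ∀ a : Fin M, A a.castSucc z * g (z (σ a.castSucc)) =
            (∑ b, B a b z * g (z (σ b.castSucc))) * g (z (σ a.castSucc)) +
            g (z (σ (Fin.last M))) * (C a z * g (z (σ a.castSucc))) := fun a => by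
          rw [hBC a z hz]; ring
        simp_rw [h3] at h1
        rw [Finset.sum_add_distrib, h2, zero_add, ← Finset.mul_sum] at h1
        linear_combination h1
    refine ⟨fun a b => Fin.lastCases (Fin.lastCases (fun _ => 0) (fun b z => - C b z) b)
      (fun a => Fin.lastCases (C a) (fun b => B a b) b) a, ?_, ?_, ?_⟩
    · intro a b
      induction a using Fin.lastCases with
      | last =>
        induction b using Fin.lastCases with
        | last => simpa using differentiableOn_const _
        | cast b => simpa using (hCd b).fun_neg
      | cast a =>
        induction b using Fin.lastCases with
        | last => simpa using hCd a
        | cast b => simpa using hBd a b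
    · intro a b z hz
      induction a using Fin.lastCases with
      | last =>
        induction b using Fin.lastCases with
        | last => simp
        | cast b => simp
      | cast a =>
        induction b using Fin.lastCases with
        | last => simp
        | cast b => simpa using hBa a b z hz
    · intro a z hz
      rw [Fin.sum_univ_castSucc]
      induction a using Fin.lastCases with
      | last =>
        have := hlast z hz
        simp only [Fin.lastCases_last, Fin.lastCases_castSucc, zero_mul, add_zero, neg_mul,
          Finset.sum_neg_distrib]
        linear_combination this
      | cast a =>
        simpa using hBC a z hz

/-- Appendix B solution of the linear `∇̃`-equation, general case: if the family
`A a` of holomorphic functions on the polyannulus satisfies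
`∑ a, A a z * g (z a) = 0` there, with `g` holomorphic and not identically zero on
the annulus, then `A a z = ∑ b, A' a b z * g (z b)` for a family `A' a b` of
holomorphic functions antisymmetric in `(a, b)`. -/
theorem linear_nabla_equation_general (ε : ℝ) (hε : 0 < ε) (g : ℂ → ℂ)
    (hg : DifferentiableOn ℂ g (annulus ε))
    (hg0 : ∃ z ∈ annulus ε, g z ≠ 0)
    (M N : ℕ) (hM : 1 ≤ M) (hMN : M ≤ N)
    (A : Fin M → (Fin N → ℂ) → ℂ)
    (hA : ∀ a, DifferentiableOn ℂ (A a) (polyAnnulus ε N))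
    (heq : ∀ z ∈ polyAnnulus ε N,
      ∑ a : Fin M, A a z * g (z (Fin.castLE hMN a)) = 0) :
    ∃ A' : Fin M → Fin M → (Fin N → ℂ) → ℂ,
      (∀ a b, DifferentiableOn ℂ (A' a b) (polyAnnulus ε N)) ∧
      (∀ a b z, A' a b z = -A' b a z) ∧
      (∀ a, ∀ z ∈ polyAnnulus ε N,
        A a z = ∑ b : Fin M, A' a b z * g (z (Fin.castLE hMN b))) := by
  obtain ⟨B, hBd, hBa, hB⟩ := solvable_all hε hg hg0 M (Fin.castLE hMN)
    (Fin.castLE_injective hMN) A hA heq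
  refine ⟨fun a b z => (1 / 2 : ℂ) * (B a b z - B b a z), ?_, ?_, ?_⟩
  · intro a b
    exact ((hBd a b).fun_sub (hBd b a)).const_mul (1 / 2 : ℂ)
  · intro a b z
    ring
  · intro a z hz
    rw [hB a z hz]
    refine Finset.sum_congr rfl fun b _ => ?_
    beta_reduce
    have h := hBa b a z hz
    linear_combination (1 / 2 : ℂ) * g (z (Fin.castLE hMN b)) * h
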